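/- arXiv:1309.5563 — 2 statements merged into one kernel-verified Lean document; each statement's English description precedes it below -/
import Mathlib

section
/- Fix an integer N > 2, set κ_N = (−1)^{1+N/2} if N is even and fix κ_N ∈ {−1,+1} if N is odd. Let #J (resp. #K) be the number of complex N-th roots of κ_N with positive (resp. negative) real part. Let λ > 0, μ > 0 and a ∈ ℝ. Suppose Φ : ℝ → ℂ is bounded, is (N−1)-times continuously differentiable on ℝ, is N-times continuously differentiable on ℝ∖{a}, and satisfies κ_N Φ^{(N)}(x) = (λ+μ) Φ(x) − 1 for all x > a and κ_N Φ^{(N)}(x) = λ Φ(x) − 1 for all x < a. Then Φ(a) = λ^{−#K/N} (λ+μ)^{−#J/N}. -/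
open MeasureTheory Real Complex Set

lemma fk_bounded_pow (N : ℕ) (c z : ℕ → ℂ) (hz : ∀ i ∈ Finset.range N, z i = z 0 → i = 0)
    (hN : 0 < N) (h1 : 1 < ‖z 0‖) (C : ℝ)
    (hb : ∀ n : ℕ, ‖∑ i ∈ Finset.range N, c i * z i ^ n‖ ≤ C) : c 0 = 0 := by
  classical
  set q : Polynomial ℂ := ∏ i ∈ (Finset.range N).erase 0, (Polynomial.X - Polynomial.C (z i)) with hq
  have hq0 : q.eval (z 0) ≠ 0 := by
    rw [hq, Polynomial.eval_prod, Finset.prod_ne_zero_iff]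
    intro i hi
    rw [Finset.mem_erase] at hi
    simp only [Polynomial.eval_sub, Polynomial.eval_X, Polynomial.eval_C, sub_ne_zero]
    intro h
    exact hi.1 (hz i hi.2 h.symm)
  have hqi : ∀ i ∈ Finset.range N, i ≠ 0 → q.eval (z i) = 0 := by
    intro i hi hi0
    rw [hq, Polynomial.eval_prod]
    apply Finset.prod_eq_zero (Finset.mem_erase.2 ⟨hi0, hi⟩)
    simp
  have key : ∀ n : ℕ, ∑ m ∈ Finset.range (q.natDegree + 1),
      q.coeff m * ∑ i ∈ Finset.range N, c i * z i ^ (n + m) = c 0 * q.eval (z 0) * z 0 ^ n := by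
    intro n
    simp_rw [Finset.mul_sum]
    rw [Finset.sum_comm]
    have : ∀ i ∈ Finset.range N, ∑ m ∈ Finset.range (q.natDegree + 1),
        q.coeff m * (c i * z i ^ (n + m)) = c i * q.eval (z i) * z i ^ n := by
      intro i _
      rw [Polynomial.eval_eq_sum_range, Finset.mul_sum, Finset.sum_mul]
      apply Finset.sum_congr rfl
      intro m _
      ring
    rw [Finset.sum_congr rfl this]
    apply Finset.sum_eq_single_of_mem 0 (Finset.mem_range.2 hN)
    intro i hi hi0
    rw [hqi i hi hi0]; ring
  by_contra hc
  have hpos : 0 < ‖c 0 * q.eval (z 0)‖ := norm_pos_iff.2 (mul_ne_zero hc hq0)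
  set B := ∑ m ∈ Finset.range (q.natDegree + 1), ‖q.coeff m‖ * C
  have hB : ∀ n : ℕ, ‖c 0 * q.eval (z 0)‖ * ‖z 0‖ ^ n ≤ B := by
    intro n
    rw [← norm_pow, ← norm_mul, ← key n]
    apply (norm_sum_le _ _).trans
    apply Finset.sum_le_sum
    intro m _
    rw [norm_mul]
    gcongr
    exact hb _
  obtain ⟨n, hn⟩ := pow_unbounded_of_one_lt (B / ‖c 0 * q.eval (z 0)‖) h1
  rw [div_lt_iff₀ hpos] at hn
  have := hB n
  linarith

lemma fk_bounded_exp (N : ℕ) (c γ : ℕ → ℂ) (hγ : ∀ i ∈ Finset.range N, γ i = γ 0 → i = 0)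
    (hN : 0 < N) (h1 : 0 < (γ 0).re) (C : ℝ)
    (hb : ∀ x : ℝ, 0 ≤ x → ‖∑ i ∈ Finset.range N, c i * cexp (γ i * x)‖ ≤ C) : c 0 = 0 := by
  set M := ∑ i ∈ Finset.range N, ‖γ i‖ with hM
  have hM0 : 0 ≤ M := Finset.sum_nonneg fun _ _ => norm_nonneg _
  set h : ℝ := 1 / (M + 1) with hh
  have hpos : 0 < h := by positivity
  have him : ∀ i ∈ Finset.range N, |(γ i * h).im| < π := by
    intro i hi
    have h2 : ‖γ i‖ ≤ M := Finset.single_le_sum (f := fun i => ‖γ i‖) (fun _ _ => norm_nonneg _) hi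
    have h3 : |(γ i * h).im| ≤ ‖γ i * h‖ := Complex.abs_im_le_norm _
    rw [norm_mul, Complex.norm_real, Real.norm_of_nonneg hpos.le] at h3
    have h4 : ‖γ i‖ * h ≤ 1 := by
      rw [hh, mul_one_div, div_le_one (by positivity)]; linarith
    have := Real.pi_gt_three
    linarith
  refine fk_bounded_pow N c (fun i => cexp (γ i * h)) ?_ hN ?_ C ?_
  · intro i hi he
    have a1 := him i hi
    have a2 := him 0 (Finset.mem_range.2 hN)
    rw [abs_lt] at a1 a2
    have := Complex.exp_inj_of_neg_pi_lt_of_le_pi a1.1 a1.2.le a2.1 a2.2.le he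
    apply hγ i hi
    have hh0 : (h : ℂ) ≠ 0 := by exact_mod_cast hpos.ne'
    exact mul_right_cancel₀ hh0 this
  · rw [Complex.norm_exp, Real.one_lt_exp_iff]
    simp
    positivity
  · intro n
    have := hb (n * h) (by positivity)
    convert this using 4 with i hi
    rw [← Complex.exp_nat_mul]
    congr 1
    push_cast; ring

lemma fk_half (N : ℕ) (hN : 0 < N) (a : ℝ) (w : ℂ) (d : ℕ → ℝ → ℂ)
    (hc : ∀ k < N, Continuous (d k))
    (hd : ∀ k < N, ∀ x, a < x → HasDerivAt (d k) (d (k+1) x) x)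
    (hw : ∀ x, a < x → d N x = w * d 0 x) (C : ℝ) (hb : ∀ x, ‖d 0 x‖ ≤ C)
    (s : ℂ) (hs : s ^ N = w) (hre : 0 < s.re) :
    ∑ k ∈ Finset.range N, s ^ (N - 1 - k) * d k a = 0 := by
  have hs0 : s ≠ 0 := by rintro rfl; simp at hre
  have hζ := Complex.isPrimitiveRoot_exp N hN.ne'
  set ζ := cexp (2 * π * I / N) with hζdef
  have hζ0 : ζ ≠ 0 := Complex.exp_ne_zero _
  -- exponential form
  have hG : ∀ t : ℂ, t ^ N = w → ∀ x, a ≤ x → ∑ k ∈ Finset.range N, t ^ (N - 1 - k) * d k x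
      = cexp (t * (x - a : ℝ)) * ∑ k ∈ Finset.range N, t ^ (N - 1 - k) * d k a := by
    intro t ht x hx
    obtain ⟨n, rfl⟩ : ∃ n, N = n + 1 := ⟨N - 1, by omega⟩
    set G : ℝ → ℂ := fun x => ∑ k ∈ Finset.range (n+1), t ^ (n + 1 - 1 - k) * d k x with hGdef
    have hGc : Continuous G := by
      apply continuous_finsetSum
      intro k hk
      exact continuous_const.mul (hc k (Finset.mem_range.1 hk))
    have hGd : ∀ y, a < y → HasDerivAt G (t * G y) y := by
      intro y hy
      have h1 : HasDerivAt G (∑ k ∈ Finset.range (n+1), t ^ (n + 1 - 1 - k) * d (k+1) y) y := by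
        apply HasDerivAt.fun_sum
        intro k hk
        exact (hd k (Finset.mem_range.1 hk) y hy).const_mul _
      convert h1 using 1
      rw [hGdef]
      simp only
      rw [Finset.sum_range_succ' (fun k => t ^ (n + 1 - 1 - k) * d k y) n,
        Finset.sum_range_succ (fun k => t ^ (n + 1 - 1 - k) * d (k + 1) y) n, hw y hy, ← ht, mul_add,
        Finset.mul_sum]
      congr 1
      · apply Finset.sum_congr rfl
        intro k hk
        have := Finset.mem_range.1 hk
        rw [show n + 1 - 1 - k = (n + 1 - 1 - (k+1)) + 1 by omega, pow_succ]
        ring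
      · simp
        ring
    set H : ℝ → ℂ := fun y => cexp (-(t * (y - a : ℝ))) * G y with hH
    have hHc : Continuous H := by
      rw [hH]
      fun_prop
    have hHd : ∀ y, a < y → HasDerivAt H 0 y := by
      intro y hy
      have h0 : HasDerivAt (fun y : ℝ => ((y - a : ℝ) : ℂ)) 1 y := by
        exact_mod_cast ((hasDerivAt_id y).sub_const a).ofReal_comp
      have h1 : HasDerivAt (fun y : ℝ => cexp (-(t * (y - a : ℝ))))
        (cexp (-(t * (y - a : ℝ))) * (-(t * 1))) y := ((h0.const_mul t).neg).cexp
      have := h1.mul (hGd y hy)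
      have e : cexp (-(t * (y - a : ℝ))) * (-(t * 1)) * G y
          + cexp (-(t * (y - a : ℝ))) * (t * G y) = 0 := by ring
      rw [e] at this
      exact this
    have hHx : H x = H a := by
      rcases hx.eq_or_lt with rfl | hx
      · rfl
      have hconst : ∀ b, a < b → H x = H b := by
        intro b hb
        have hdiff : DifferentiableOn ℝ H (Ioi a) := fun y hy =>
          (hHd y hy).differentiableAt.differentiableWithinAt
        exact isOpen_Ioi.is_const_of_deriv_eq_zero isPreconnected_Ioi hdiff
          (fun y hy => (hHd y hy).deriv) hx hb
      have hlim : Filter.Tendsto H (nhdsWithin a (Ioi a)) (nhds (H a)) :=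
        hHc.continuousAt.tendsto.mono_left nhdsWithin_le_nhds
      have hlim2 : Filter.Tendsto H (nhdsWithin a (Ioi a)) (nhds (H x)) := by
        apply tendsto_const_nhds.congr'
        filter_upwards [self_mem_nhdsWithin] with b hb
        exact hconst b hb
      exact tendsto_nhds_unique hlim2 hlim
    change G x = cexp (t * (x - a : ℝ)) * G a
    simp only [hH, sub_self, Complex.ofReal_zero, mul_zero, neg_zero, Complex.exp_zero,
      one_mul] at hHx
    rw [← hHx, ← mul_assoc, ← Complex.exp_add, add_neg_cancel, Complex.exp_zero, one_mul]
  set γ : ℕ → ℂ := fun j => s * ζ ^ j with hγ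
  have hγN : ∀ j, γ j ^ N = w := by
    intro j
    simp only [hγ]
    rw [mul_pow, ← pow_mul, mul_comm j, pow_mul, hζ.pow_eq_one, one_pow, mul_one, hs]
  have hsum : ∀ x, ∑ j ∈ Finset.range N, γ j * ∑ k ∈ Finset.range N, γ j ^ (N - 1 - k) * d k x
      = N * w * d 0 x := by
    intro x
    simp_rw [Finset.mul_sum]
    rw [Finset.sum_comm]
    rw [Finset.sum_eq_single_of_mem 0 (Finset.mem_range.2 hN)]
    · have : ∀ j ∈ Finset.range N, γ j * (γ j ^ (N - 1 - 0) * d 0 x) = w * d 0 x := by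
        intro j _
        rw [← hγN j, ← mul_assoc, ← pow_succ']
        congr 2; omega
      rw [Finset.sum_congr rfl this]
      simp [mul_assoc]
    · intro k hk hk0
      have hk := Finset.mem_range.1 hk
      have : ∀ j ∈ Finset.range N, γ j * (γ j ^ (N - 1 - k) * d k x)
          = s ^ (N - k) * d k x * (ζ ^ (N - k)) ^ j := by
        intro j _
        rw [← mul_assoc, ← pow_succ', show N - 1 - k + 1 = N - k by omega]
        simp only [hγ]
        rw [mul_pow, ← pow_mul, ← pow_mul, mul_comm j]; ring
      rw [Finset.sum_congr rfl this, ← Finset.mul_sum]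
      have hne : ζ ^ (N - k) ≠ 1 := hζ.pow_ne_one_of_pos_of_lt (by omega) (by omega)
      rw [geom_sum_eq hne, ← pow_mul, mul_comm (N-k), pow_mul, hζ.pow_eq_one]
      simp
  have := fk_bounded_exp N (fun j => γ j * ∑ k ∈ Finset.range N, γ j ^ (N - 1 - k) * d k a) γ
    ?_ hN (by simpa [hγ] using hre) (‖(N * w : ℂ)‖ * C) ?_
  · simpa [hγ, hs0] using this
  · intro i hi h
    simp only [hγ] at h
    have h := mul_left_cancel₀ hs0 h
    exact hζ.pow_inj (Finset.mem_range.1 hi) hN h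
  · intro x hx
    have h1 : ∑ i ∈ Finset.range N, (γ i * ∑ k ∈ Finset.range N, γ i ^ (N - 1 - k) * d k a)
        * cexp (γ i * x) = N * w * d 0 (a + x) := by
      rw [← hsum]
      apply Finset.sum_congr rfl
      intro i _
      rw [hG (γ i) (hγN i) (a + x) (by linarith), add_sub_cancel_left]
      ring
    rw [h1, norm_mul]
    gcongr
    exact hb _

lemma fk_side (N : ℕ) (hN : 0 < N) (a : ℝ) (κ : ℂ) (hκ : κ * κ = 1) (p : ℝ) (hp : 0 < p)
    (d : ℕ → ℝ → ℂ)
    (hc : ∀ k < N, Continuous (d k))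
    (hd : ∀ k < N, ∀ x, a < x → HasDerivAt (d k) (d (k+1) x) x)
    (hw : ∀ x, a < x → κ * d N x = p * d 0 x - 1) (C : ℝ) (hb : ∀ x, ‖d 0 x‖ ≤ C)
    (s : ℂ) (hs : s ^ N = κ * p) (hre : 0 < s.re) :
    ∑ k ∈ Finset.range N, s ^ (N - k) * d k a = κ := by
  have hp0 : (p : ℂ) ≠ 0 := by exact_mod_cast hp.ne'
  have := fk_half N hN a (κ * p) (fun k x => d k x - if k = 0 then (p : ℂ)⁻¹ else 0) ?_ ?_ ?_
    (C + ‖(p : ℂ)⁻¹‖) ?_ s hs hre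
  · have h2 : s * ∑ k ∈ Finset.range N, s ^ (N - 1 - k) *
        (d k a - if k = 0 then (p : ℂ)⁻¹ else 0) = 0 := by rw [this, mul_zero]
    rw [Finset.mul_sum] at h2
    have h3 : ∀ k ∈ Finset.range N, s * (s ^ (N - 1 - k) *
        (d k a - if k = 0 then (p : ℂ)⁻¹ else 0)) = s ^ (N - k) * d k a -
          if k = 0 then s ^ N * (p : ℂ)⁻¹ else 0 := by
      intro k hk
      have hk := Finset.mem_range.1 hk
      rw [← mul_assoc, ← pow_succ', show N - 1 - k + 1 = N - k by omega]
      split_ifs with h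
      · subst h; simp; ring
      · simp
    rw [Finset.sum_congr rfl h3, Finset.sum_sub_distrib, Finset.sum_ite_eq' (Finset.range N) 0,
      if_pos (Finset.mem_range.2 hN), hs, mul_assoc, mul_inv_cancel₀ hp0, mul_one] at h2
    exact sub_eq_zero.1 h2
  · intro k hk
    exact (hc k hk).sub continuous_const
  · intro k hk x hx
    have := (hd k hk x hx).sub_const (if k = 0 then (p : ℂ)⁻¹ else 0)
    simpa using this
  · intro x hx
    simp only [if_neg hN.ne', if_true, sub_zero]
    have h1 := hw x hx
    have h2 : d N x = κ * (κ * d N x) := by rw [← mul_assoc, hκ, one_mul]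
    rw [h2, h1]
    field_simp
  · intro x
    simp only [if_true]
    exact (norm_sub_le _ _).trans (by gcongr; exact hb x)

lemma fk_prod (N : ℕ) (hN : 0 < N) (κ : ℂ) (hκ : κ ≠ 0) :
    (Polynomial.nthRootsFinset N κ).card = N ∧
    ∏ θ ∈ Polynomial.nthRootsFinset N κ, (-θ) = -κ := by
  classical
  have hζ := Complex.isPrimitiveRoot_exp N hN.ne'
  obtain ⟨α, hα⟩ : ∃ α : ℂ, α ^ N = κ := IsAlgClosed.exists_pow_nat_eq κ hN
  have hcard : Multiset.card (Polynomial.nthRoots N κ) = N := by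
    rw [hζ.card_nthRoots, if_pos ⟨α, hα⟩]
  have hnd := hζ.nthRoots_nodup hκ
  have hfin : (Polynomial.nthRootsFinset N κ) = ⟨_, hnd⟩ := by
    rw [Polynomial.nthRootsFinset_def, Multiset.toFinset_eq hnd]
  refine ⟨by rw [hfin]; exact hcard, ?_⟩
  have hsp := Polynomial.prod_multiset_X_sub_C_of_monic_of_roots_card_eq
    (Polynomial.monic_X_pow_sub_C κ hN.ne') (by
      rw [Polynomial.natDegree_X_pow_sub_C]; exact hcard)
  have h2 := congrArg (Polynomial.eval 0) hsp
  rw [Polynomial.eval_multiset_prod, Multiset.map_map] at h2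
  simp only [Polynomial.eval_sub, Polynomial.eval_pow, Polynomial.eval_X, Polynomial.eval_C,
    Function.comp_def, zero_sub, zero_pow hN.ne'] at h2
  rw [hfin]
  exact h2

lemma fk_interp (N : ℕ) (hN : 0 < N) (κ : ℂ) (v : ℕ → ℂ) (R : Finset ℂ) (hR : R.card = N)
    (ν : ℂ → ℂ) (hν : Set.InjOn ν R)
    (h : ∀ θ ∈ R, ∑ k ∈ Finset.range N, ν θ ^ (N - k) * v k = κ) :
    -κ = v 0 * ∏ θ ∈ R, (-ν θ) := by
  obtain ⟨n, rfl⟩ : ∃ n, N = n + 1 := ⟨N - 1, by omega⟩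
  set f : Polynomial ℂ := ∑ k ∈ Finset.range n,
    Polynomial.C (v (k+1)) * Polynomial.X ^ (n - k) - Polynomial.C κ with hf
  set P : Polynomial ℂ := ∏ θ ∈ R, (Polynomial.X - Polynomial.C (ν θ)) with hP
  have hPm : P.Monic := Polynomial.monic_prod_of_monic _ _ fun _ _ => Polynomial.monic_X_sub_C _
  have hPd : P.degree = (n + 1 : ℕ) := by
    rw [hP, Polynomial.degree_prod]; simp [hR]
  have hfd : f.degree < (R.card : WithBot ℕ) := by
    rw [hR, ← Polynomial.mem_degreeLT]
    apply Submodule.sub_mem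
    · apply Submodule.sum_mem
      intro k hk
      rw [Polynomial.mem_degreeLT]
      apply (Polynomial.degree_C_mul_X_pow_le _ _).trans_lt
      have := Finset.mem_range.1 hk
      exact_mod_cast (by omega : n - k < n + 1)
    · rw [Polynomial.mem_degreeLT]
      apply Polynomial.degree_C_le.trans_lt
      exact_mod_cast (by omega : 0 < n + 1)
  have hgd : (Polynomial.C (v 0) * (P - Polynomial.X ^ (n + 1))).degree < (R.card : WithBot ℕ) := by
    rw [← Polynomial.mem_degreeLT, Polynomial.C_mul']
    apply Submodule.smul_mem
    rw [Polynomial.mem_degreeLT, hR, ← hPd]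
    apply Polynomial.degree_sub_lt_left
    · rw [hPd]; simp
    · exact hPm.ne_zero
    · rw [hPm.leadingCoeff]; simp
  have key := Polynomial.eq_of_degrees_lt_of_eval_index_eq (s := R) (v := ν) hν hfd hgd (by
    intro θ hθ
    have h1 := h θ hθ
    rw [Finset.sum_range_succ'] at h1
    have hP0 : P.eval (ν θ) = 0 := by
      rw [hP, Polynomial.eval_prod]
      apply Finset.prod_eq_zero hθ
      simp
    rw [hf]
    simp only [Polynomial.eval_sub, Polynomial.eval_finsetSum, Polynomial.eval_mul,
      Polynomial.eval_pow, Polynomial.eval_X, Polynomial.eval_C, hP0]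
    rw [← h1]
    simp only [Nat.add_sub_add_right, Nat.sub_zero, mul_comm]
    ring)
  have h2 := congrArg (Polynomial.eval 0) key
  rw [hf, hP] at h2
  simp only [Polynomial.eval_sub, Polynomial.eval_finsetSum, Polynomial.eval_mul,
      Polynomial.eval_pow, Polynomial.eval_X, Polynomial.eval_C, Polynomial.eval_prod] at h2
  rw [Finset.sum_eq_zero] at h2
  · simpa using h2
  · intro k hk
    have := Finset.mem_range.1 hk
    rw [zero_pow (by omega), mul_zero]

lemma fk_re_ne (N : ℕ) (κ : ℂ)
    (hκeven : Even N → κ = (-1 : ℂ) ^ (1 + N / 2))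
    (hκodd : ¬ Even N → κ = 1 ∨ κ = -1) (θ : ℂ) (h : θ ^ N = κ) : θ.re ≠ 0 := by
  intro h0
  obtain ⟨y, rfl⟩ : ∃ y : ℝ, θ = y * I := ⟨θ.im, by
    apply Complex.ext <;> simp [h0]⟩
  rw [mul_pow] at h
  by_cases hN : Even N
  · rw [hκeven hN] at h
    obtain ⟨m, rfl⟩ := hN
    rw [show (m + m) / 2 = m by omega, ← two_mul, pow_mul I, I_sq, pow_add, pow_one] at h
    have h3 : (y : ℂ) ^ (2 * m) = -1 := by
      apply mul_right_cancel₀ (b := (-1 : ℂ) ^ m) (by simp) h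
    have h4 : y ^ (2 * m) = -1 := by exact_mod_cast h3
    rw [pow_mul] at h4
    have : 0 ≤ (y ^ 2) ^ m := by positivity
    linarith
  · obtain ⟨m, rfl⟩ := Nat.not_even_iff_odd.1 hN
    rw [pow_succ I, pow_mul I, I_sq] at h
    have h5 := congrArg Complex.re h
    have h6 : ((y : ℂ) ^ (2 * m + 1) * ((-1) ^ m * I)).re = 0 := by
      have : (y : ℂ) ^ (2 * m + 1) * ((-1) ^ m * I) = ((y ^ (2 * m + 1) * (-1) ^ m : ℝ) : ℂ) * I := by
        push_cast; ring
      rw [this]; simp only [Complex.re_ofReal_mul, Complex.I_re, mul_zero]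
    rw [h6] at h5
    rcases hκodd hN with h7 | h7 <;> rw [h7] at h5 <;> simp at h5

/-- Feynman–Kac boundary value problem for the sojourn time: if `Φ` is a bounded,
`(N−1)`-times continuously differentiable solution on `ℝ`, `N`-times continuously
differentiable off `{a}`, of `κ_N Φ^{(N)} = (λ+μ)Φ − 1` on `(a,∞)` and
`κ_N Φ^{(N)} = λΦ − 1` on `(−∞,a)`, then `Φ(a) = λ^{−#K/N} (λ+μ)^{−#J/N}`. -/
theorem feynman_kac_sojourn (N : ℕ) (hN : 2 < N) (κ : ℂ)
    (hκeven : Even N → κ = (-1 : ℂ) ^ (1 + N / 2))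
    (hκodd : ¬ Even N → κ = 1 ∨ κ = -1)
    (lam μ a : ℝ) (hlam : 0 < lam) (hμ : 0 < μ)
    (Φ : ℝ → ℂ)
    (hbound : ∃ C : ℝ, ∀ x : ℝ, ‖Φ x‖ ≤ C)
    (hsmooth : ContDiff ℝ (N - 1 : ℕ) Φ)
    (hsmooth' : ContDiffOn ℝ (N : ℕ) Φ {a}ᶜ)
    (hode_above : ∀ x : ℝ, a < x →
      κ * iteratedDeriv N Φ x = ((lam : ℂ) + (μ : ℂ)) * Φ x - 1)
    (hode_below : ∀ x : ℝ, x < a →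
      κ * iteratedDeriv N Φ x = (lam : ℂ) * Φ x - 1) :
    Φ a = ((lam ^ (-(({θ : ℂ | θ ^ N = κ ∧ θ.re < 0}.ncard : ℝ)) / (N : ℝ)) : ℝ) : ℂ) *
          (((lam + μ) ^ (-(({θ : ℂ | θ ^ N = κ ∧ 0 < θ.re}.ncard : ℝ)) / (N : ℝ)) : ℝ) : ℂ) := by
  classical
  have hN0 : 0 < N := by omega
  have hκ : κ * κ = 1 := by
    by_cases h : Even N
    · rw [hκeven h, ← mul_pow]; simp
    · rcases hκodd h with h | h <;> rw [h] <;> norm_num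
  have hκ0 : κ ≠ 0 := by rintro rfl; simp at hκ
  obtain ⟨C, hC⟩ := hbound
  have hp : 0 < lam + μ := by linarith
  -- regularity
  have hcont : ∀ k < N, Continuous (iteratedDeriv k Φ) := by
    intro k hk
    exact hsmooth.continuous_iteratedDeriv k (by exact_mod_cast (by omega : k ≤ N - 1))
  have hder : ∀ k < N, ∀ x, x ≠ a →
      HasDerivAt (iteratedDeriv k Φ) (iteratedDeriv (k + 1) Φ x) x := by
    intro k hk x hx
    have h1 : ContDiffAt ℝ (N : ℕ) Φ x :=
      hsmooth'.contDiffAt (isOpen_compl_singleton.mem_nhds hx)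
    have h2 : DifferentiableAt ℝ (iteratedDeriv k Φ) x := by
      have := (h1.contDiffWithinAt (s := Set.univ)).differentiableWithinAt_iteratedDerivWithin
        (m := k) (by exact_mod_cast hk) (by simp)
      rw [iteratedDerivWithin_univ, differentiableWithinAt_univ] at this
      exact this
    rw [iteratedDeriv_succ]
    exact h2.hasDerivAt
  have habove : ∀ s : ℂ, s ^ N = κ * (lam + μ : ℝ) → 0 < s.re →
      ∑ k ∈ Finset.range N, s ^ (N - k) * iteratedDeriv k Φ a = κ := by
    intro s hs hre
    refine fk_side N hN0 a κ hκ (lam + μ) hp (fun k => iteratedDeriv k Φ) hcont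
      (fun k hk x hx => hder k hk x hx.ne') ?_ C ?_ s hs hre
    · intro x hx
      rw [hode_above x hx]; simp
    · intro x; simpa using hC x
  have hbelow : ∀ s : ℂ, s ^ N = κ * (lam : ℝ) → s.re < 0 →
      ∑ k ∈ Finset.range N, s ^ (N - k) * iteratedDeriv k Φ a = κ := by
    intro s hs hre
    have h1 := fk_side N hN0 (-a) ((-1) ^ N * κ)
      (by rw [mul_mul_mul_comm, hκ, ← mul_pow]; simp) lam hlam
      (fun k x => (-1) ^ k * iteratedDeriv k Φ (-x))
      (fun k hk => continuous_const.mul ((hcont k hk).comp continuous_neg)) ?_ ?_ C ?_ (-s)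
      (by rw [neg_pow, hs]; ring) (by simpa using hre)
    · have h2 : ∀ k ∈ Finset.range N, (-s) ^ (N - k) * ((-1) ^ k * iteratedDeriv k Φ (- -a))
          = (-1) ^ N * (s ^ (N - k) * iteratedDeriv k Φ a) := by
        intro k hk
        have hk := Finset.mem_range.1 hk
        rw [neg_pow s, neg_neg]
        have : (-1 : ℂ) ^ N = (-1) ^ (N - k) * (-1) ^ k := by
          rw [← pow_add]; congr 1; omega
        rw [this]; ring
      rw [Finset.sum_congr rfl h2, ← Finset.mul_sum] at h1
      exact mul_left_cancel₀ (by simp) h1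
    · intro k hk x hx
      have h3 := hder k hk (-x) (by intro h; linarith)
      have h4 := (h3.scomp x (hasDerivAt_neg x)).const_mul ((-1 : ℂ) ^ k)
      have e : (-1 : ℂ) ^ k * ((-1 : ℝ) • iteratedDeriv (k + 1) Φ (-x))
          = (-1) ^ (k + 1) * iteratedDeriv (k + 1) Φ (-x) := by
        rw [pow_succ]; simp
      rw [← e]
      exact h4
    · intro x hx
      have h3 := hode_below (-x) (by linarith)
      simp only [pow_zero, one_mul, iteratedDeriv_zero]
      rw [← h3, show (-1 : ℂ) ^ N * κ * ((-1) ^ N * iteratedDeriv N Φ (-x)) =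
        ((-1) ^ N * (-1) ^ N) * (κ * iteratedDeriv N Φ (-x)) by ring, ← mul_pow]
      simp
    · intro x; simpa using hC (-x)
  -- nodes
  obtain ⟨hcard, hprod⟩ := fk_prod N hN0 κ hκ0
  set R := Polynomial.nthRootsFinset N κ with hR
  have hmem : ∀ θ, θ ∈ R ↔ θ ^ N = κ := fun θ => Polynomial.mem_nthRootsFinset hN0 κ
  have hre : ∀ θ ∈ R, θ.re ≠ 0 := fun θ hθ => fk_re_ne N κ hκeven hκodd θ ((hmem θ).1 hθ)
  have hNR : (N : ℝ) ≠ 0 := by exact_mod_cast hN0.ne'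
  set α : ℝ := (lam + μ) ^ (1 / (N : ℝ)) with hα
  set β : ℝ := lam ^ (1 / (N : ℝ)) with hβ
  have hα0 : 0 < α := Real.rpow_pos_of_pos hp _
  have hβ0 : 0 < β := Real.rpow_pos_of_pos hlam _
  have hαN : α ^ N = lam + μ := by
    rw [hα, ← Real.rpow_natCast, ← Real.rpow_mul hp.le, one_div_mul_cancel hNR, Real.rpow_one]
  have hβN : β ^ N = lam := by
    rw [hβ, ← Real.rpow_natCast, ← Real.rpow_mul hlam.le, one_div_mul_cancel hNR, Real.rpow_one]
  set ν : ℂ → ℂ := fun θ => (if 0 < θ.re then (α : ℂ) else β) * θ with hν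
  have hαc : (α : ℂ) ≠ 0 := by exact_mod_cast hα0.ne'
  have hβc : (β : ℂ) ≠ 0 := by exact_mod_cast hβ0.ne'
  have hinj : Set.InjOn ν R := by
    intro x hx y hy hxy
    simp only [hν] at hxy
    split_ifs at hxy with h1 h2 h2
    · exact mul_left_cancel₀ hαc hxy
    · have := congrArg Complex.re hxy
      simp only [Complex.re_ofReal_mul] at this
      nlinarith [mul_pos hα0 h1]
    · have := congrArg Complex.re hxy
      simp only [Complex.re_ofReal_mul] at this
      nlinarith [mul_pos hα0 h2]
    · exact mul_left_cancel₀ hβc hxy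
  have hfin := fk_interp N hN0 κ (fun k => iteratedDeriv k Φ a) R hcard ν hinj (by
    intro θ hθ
    have hθN := (hmem θ).1 hθ
    rcases (hre θ hθ).lt_or_gt with h | h
    · apply hbelow
      · simp only [hν, if_neg h.not_gt]
        rw [mul_pow, hθN, ← Complex.ofReal_pow, hβN, mul_comm]
      · simp only [hν, if_neg h.not_gt, Complex.re_ofReal_mul]
        nlinarith
    · apply habove
      · simp only [hν, if_pos h]
        rw [mul_pow, hθN, ← Complex.ofReal_pow, hαN, mul_comm]
      · simp only [hν, if_pos h, Complex.re_ofReal_mul]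
        positivity)
  have hJ : {θ : ℂ | θ ^ N = κ ∧ 0 < θ.re}.ncard = (R.filter (fun θ => 0 < θ.re)).card := by
    rw [← Set.ncard_coe_finset]
    congr 1
    ext θ
    simp [hmem]
  have hK : {θ : ℂ | θ ^ N = κ ∧ θ.re < 0}.ncard = (R.filter (fun θ => ¬ 0 < θ.re)).card := by
    rw [← Set.ncard_coe_finset]
    congr 1
    ext θ
    simp only [Set.mem_ofPred_eq, Finset.coe_filter, hmem, not_lt]
    constructor
    · rintro ⟨h1, h2⟩; exact ⟨h1, h2.le⟩
    · rintro ⟨h1, h2⟩; exact ⟨h1, lt_of_le_of_ne h2 (hre θ ((hmem θ).2 h1))⟩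
  rw [hJ, hK]
  set j := (R.filter (fun θ => 0 < θ.re)).card
  set k := (R.filter (fun θ => ¬ 0 < θ.re)).card
  have hprod2 : ∏ θ ∈ R, (-ν θ) = (α : ℂ) ^ j * (β : ℂ) ^ k * (-κ) := by
    have : ∀ θ ∈ R, -ν θ = (if 0 < θ.re then (α : ℂ) else β) * (-θ) := by
      intro θ _; simp only [hν]; ring
    rw [Finset.prod_congr rfl this, Finset.prod_mul_distrib, hprod, Finset.prod_ite]
    simp [j, k]
  have e1 : lam ^ (-(k : ℝ) / (N : ℝ)) = (β ^ k)⁻¹ := by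
    rw [hβ, ← Real.rpow_natCast, ← Real.rpow_mul hlam.le, ← Real.rpow_neg hlam.le]
    congr 1; ring
  have e2 : (lam + μ) ^ (-(j : ℝ) / (N : ℝ)) = (α ^ j)⁻¹ := by
    rw [hα, ← Real.rpow_natCast, ← Real.rpow_mul hp.le, ← Real.rpow_neg hp.le]
    congr 1; ring
  rw [e1, e2]
  rw [hprod2] at hfin
  simp only [iteratedDeriv_zero] at hfin
  have h9 : Φ a * ((α : ℂ) ^ j * (β : ℂ) ^ k) = 1 := by
    apply mul_right_cancel₀ (neg_ne_zero.2 hκ0)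
    rw [one_mul]
    rw [mul_assoc]; exact hfin.symm
  push_cast
  rw [← mul_inv, mul_comm ((β : ℂ) ^ k)]
  exact eq_inv_of_mul_eq_one_left h9
end

section
/- For t > 0 and ξ < 0 define 𝒥_0(t;ξ) = (ξ/(2πt)) ∫_0^∞ ( e^{ξr} − cos(ξr) + sin(ξr) ) e^{−t r^4} dr. Then for every λ > 0 and every ξ < 0, ∫_0^∞ e^{−λt} 𝒥_0(t;ξ) dt = √2 · e^{λ^{1/4} ξ/√2} · cos( λ^{1/4} ξ/√2 + π/4 ). -/
open MeasureTheory Real Set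

/-- Nishioka's hitting-time density for the biharmonic pseudo-process:
`𝒥_0(t;ξ) = (ξ/(2πt)) ∫_0^∞ (e^{ξr} − cos(ξr) + sin(ξr)) e^{−t r^4} dr`. -/
noncomputable def J0 (t ξ : ℝ) : ℝ :=
  (ξ / (2 * Real.pi * t)) *
    ∫ r in Set.Ioi (0 : ℝ),
      (Real.exp (ξ * r) - Real.cos (ξ * r) + Real.sin (ξ * r)) * Real.exp (-t * r ^ 4)


lemma side_log (c d s p : ℂ) (R : ℝ)
    (h : ∀ x ∈ Set.uIcc 0 R, s * (c + (x:ℂ) * d - p) ∈ Complex.slitPlane) :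
    d * ∫ x in (0:ℝ)..R, (c + (x:ℂ) * d - p)⁻¹
      = Complex.log (s * (c + R * d - p)) - Complex.log (s * (c - p)) := by
  have hne : ∀ x ∈ Set.uIcc 0 R, s ≠ 0 ∧ (c + (x:ℂ) * d - p) ≠ 0 := by
    intro x hx
    have := Complex.slitPlane_ne_zero (h x hx)
    exact ⟨left_ne_zero_of_mul this, right_ne_zero_of_mul this⟩
  rw [← intervalIntegral.integral_const_mul]
  have key := intervalIntegral.integral_eq_sub_of_hasDerivAt (a := 0) (b := R)
    (f := fun x : ℝ => Complex.log (s * (c + (x:ℂ) * d - p)))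
    (f' := fun x : ℝ => d * (c + (x:ℂ) * d - p)⁻¹) ?_ ?_
  · rw [key]; simp
  · intro x hx
    have h1 : HasDerivAt (fun x : ℝ => s * (c + (x:ℂ) * d - p)) (s * (1 * d)) x :=
      ((((Complex.ofRealCLM.hasDerivAt (x := x)).mul_const d).const_add c).sub_const p).const_mul s
    have := h1.clog_real (h x hx)
    obtain ⟨a, b⟩ := hne x hx
    exact this.congr_deriv (by rw [one_mul, mul_div_mul_left _ _ a, div_eq_mul_inv])
  · apply ContinuousOn.intervalIntegrable
    apply ContinuousOn.mul continuousOn_const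
    apply ContinuousOn.inv₀
    · fun_prop
    · exact fun x hx => (hne x hx).2

lemma log_neg_of_im_neg (z : ℂ) (h : z.im < 0) : Complex.log (-z) = Complex.log z + π * Complex.I := by
  simp only [Complex.log, norm_neg, Complex.arg_neg_eq_arg_add_pi_of_im_neg h]
  push_cast; ring

open Complex in
lemma rect_inv (p : ℂ) (R : ℝ) (h1 : 0 < p.re) (h2 : p.re < R) (h3 : 0 < p.im) (h4 : p.im < R) :
    (∫ x in (0:ℝ)..R, ((x:ℂ) - p)⁻¹) - (∫ x in (0:ℝ)..R, ((x:ℂ) + R * I - p)⁻¹)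
      + I * (∫ y in (0:ℝ)..R, ((R:ℂ) + y * I - p)⁻¹) - I * (∫ y in (0:ℝ)..R, ((y:ℂ) * I - p)⁻¹)
      = 2 * π * I := by
  have e1 := side_log 0 1 1 p R (by
    intro x _; rw [mem_slitPlane_iff]; right; simp; exact h3.ne')
  have e2 := side_log (R * I) 1 1 p R (by
    intro x _; rw [mem_slitPlane_iff]; right; simp; exact (sub_pos.2 h4).ne')
  have e3 := side_log R I 1 p R (by
    intro x _; rw [mem_slitPlane_iff]; left; simp; exact h2)
  have e4 := side_log 0 I (-1) p R (by
    intro x _; rw [mem_slitPlane_iff]; left; simp; exact h1)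
  simp only [mul_one, one_mul, zero_add, zero_sub] at e1 e2 e3 e4
  have a1 : ∀ x : ℝ, (x:ℂ) + R * I - p = R * I + x - p := fun x => by ring
  simp only [a1]
  rw [e1, e2, e3, e4]
  have l1 := log_neg_of_im_neg (-p) (by simpa using h3)
  have l2 := log_neg_of_im_neg (-1 * (R * I - p)) (by simp; exact h4)
  rw [show -(-1 * (R * I - p)) = R * I - p by ring] at l2
  rw [neg_neg] at l1
  rw [l2, show (-1 : ℂ) * -p = p by ring, l1]
  ring_nf

open Complex in
lemma rect_res (φ : ℂ → ℂ) (p : ℂ) (R : ℝ) (h1 : 0 < p.re) (h2 : p.re < R) (h3 : 0 < p.im)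
    (h4 : p.im < R) (hφ : ∀ z : ℂ, 0 ≤ z.re → 0 ≤ z.im → DifferentiableAt ℂ φ z) :
    (∫ x in (0:ℝ)..R, φ x / ((x:ℂ) - p)) - (∫ x in (0:ℝ)..R, φ (x + R * I) / ((x:ℂ) + R * I - p))
      + I * (∫ y in (0:ℝ)..R, φ (R + y * I) / ((R:ℂ) + y * I - p))
      - I * (∫ y in (0:ℝ)..R, φ (y * I) / ((y:ℂ) * I - p))
      = 2 * π * I * φ p := by
  have hR : 0 < R := h1.trans h2
  set S : Set ℂ := (Set.uIcc 0 R ×ℂ Set.uIcc 0 R) with hS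
  have hSn : S ∈ nhds p := by
    have : (Set.Ioo 0 R ×ℂ Set.Ioo 0 R) ∈ nhds p :=
      (isOpen_Ioo.reProdIm isOpen_Ioo).mem_nhds ⟨⟨h1, h2⟩, ⟨h3, h4⟩⟩
    refine Filter.mem_of_superset this ?_
    intro z hz
    rw [hS, Set.uIcc_of_le hR.le]
    exact ⟨Ioo_subset_Icc_self hz.1, Ioo_subset_Icc_self hz.2⟩
  have hd : DifferentiableOn ℂ (dslope φ p) S := by
    rw [differentiableOn_dslope hSn]
    intro z hz
    rw [hS, Set.uIcc_of_le hR.le] at hz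
    exact (hφ z hz.1.1 hz.2.1).differentiableWithinAt
  have key := integral_boundary_rect_eq_zero_of_differentiableOn (dslope φ p) 0 (R + R * I)
    (by simpa [hS] using hd)
  have hc : ∀ γ : ℝ → ℂ, Continuous γ → (∀ x, γ x ≠ p) → (∀ x ∈ Set.uIcc 0 R, 0 ≤ (γ x).re ∧ 0 ≤ (γ x).im) →
      ∫ x in (0:ℝ)..R, dslope φ p (γ x) = (∫ x in (0:ℝ)..R, φ (γ x) / (γ x - p))
        - φ p * ∫ x in (0:ℝ)..R, (γ x - p)⁻¹ := by
    intro γ hγ hne hpos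
    have hne' : ∀ x, γ x - p ≠ 0 := fun x => sub_ne_zero.2 (hne x)
    rw [← intervalIntegral.integral_const_mul, ← intervalIntegral.integral_sub]
    · apply intervalIntegral.integral_congr
      intro x _
      simp only [dslope_of_ne _ (hne x), slope_def_field]
      ring
    · apply ContinuousOn.intervalIntegrable
      refine ContinuousOn.div ?_ (by fun_prop) (fun x _ => hne' x)
      intro x hx
      obtain ⟨q1, q2⟩ := hpos x hx
      exact ((hφ _ q1 q2).continuousAt.comp hγ.continuousAt).continuousWithinAt
    · apply Continuous.intervalIntegrable
      refine continuous_const.mul (Continuous.inv₀ (by fun_prop) hne')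
  have k1 := hc (fun x => (x:ℂ)) (by fun_prop) (by intro x hx; rw [← hx] at h3; simp at h3)
    (by intro x hx; rw [Set.uIcc_of_le hR.le] at hx; simpa using hx.1)
  have k2 := hc (fun x => (x:ℂ) + R * I) (by fun_prop) (by intro x hx; rw [← hx] at h4; simp at h4)
    (by intro x hx; rw [Set.uIcc_of_le hR.le] at hx; simpa using ⟨hx.1, hR.le⟩)
  have k3 := hc (fun x => (R:ℂ) + x * I) (by fun_prop) (by intro x hx; rw [← hx] at h2; simp at h2)
    (by intro x hx; rw [Set.uIcc_of_le hR.le] at hx; simpa using ⟨hR.le, hx.1⟩)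
  have k4 := hc (fun x => (x:ℂ) * I) (by fun_prop) (by intro x hx; rw [← hx] at h1; simp at h1)
    (by intro x hx; rw [Set.uIcc_of_le hR.le] at hx; simpa using hx.1)
  simp only [zero_re, zero_im, add_re, add_im, ofReal_re, ofReal_im, mul_re, mul_im, I_re, I_im,
    mul_zero, mul_one, sub_zero, add_zero, zero_add, ofReal_zero, zero_mul, smul_eq_mul] at key
  rw [k1, k2, k3, k4] at key
  have := rect_inv p R h1 h2 h3 h4
  linear_combination key + φ p * this

open Complex in
lemma fac_aux (a : ℝ) (z : ℂ) : ((4 * a ^ 4 : ℝ) : ℂ) + z ^ 4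
    = (z - (a + a * I)) * ((z + (a + a * I)) * (z ^ 2 + (a + a * I) ^ 2)) := by
  push_cast
  have : (a + a * I : ℂ) ^ 4 = - (4 * a ^ 4) := by
    have : (a + a * I : ℂ) ^ 4 = a ^ 4 * ((1 + I) ^ 2) ^ 2 := by ring
    rw [this, show ((1:ℂ) + I) ^ 2 = 2 * I by ring_nf; simp, mul_pow, I_sq]; ring
  linear_combination this

open Complex in
lemma fac_ne (a : ℝ) (ha : 0 < a) (z : ℂ) (h1 : 0 ≤ z.re) (h2 : 0 ≤ z.im) :
    ((z + (a + a * I)) * (z ^ 2 + (a + a * I) ^ 2)) ≠ 0 := by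
  have e : z ^ 2 + (a + a * I : ℂ) ^ 2 = (z - (a - a * I)) * (z + (a - a * I)) := by
    linear_combination (2 * a ^ 2 : ℂ) * I_sq
  rw [e]
  refine mul_ne_zero ?_ (mul_ne_zero ?_ ?_)
  · intro h; have := congrArg Complex.re h; simp at this; linarith
  · intro h; have := congrArg Complex.im h; simp at this; linarith
  · intro h; have := congrArg Complex.re h; simp at this; linarith

open Complex in
lemma contour_eq (a ξ : ℝ) (ha : 0 < a) (R : ℝ) (hR : a < R) (F : ℂ → ℂ)
    (hF : F = fun z => Complex.exp (-ξ * z * I) * z ^ 3 / (((4 * a ^ 4 : ℝ) : ℂ) + z ^ 4)) :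
    (∫ x in (0:ℝ)..R, F x) - (∫ x in (0:ℝ)..R, F (x + R * I))
      + I * (∫ y in (0:ℝ)..R, F (R + y * I)) - I * (∫ y in (0:ℝ)..R, F (y * I))
      = 2 * π * I * (Complex.exp (-ξ * (a + a * I) * I) / 4) := by
  have := rect_res (fun z => Complex.exp (-ξ * z * I) * z ^ 3 /
    ((z + (a + a * I)) * (z ^ 2 + (a + a * I) ^ 2))) (a + a * I) R (by simpa) (by simpa)
    (by simpa) (by simpa) (by
      intro z h1 h2
      exact DifferentiableAt.div (by fun_prop) (by fun_prop) (fac_ne a ha z h1 h2))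
  have hF' : ∀ z : ℂ, F z = Complex.exp (-ξ * z * I) * z ^ 3 /
    ((z + (a + a * I)) * (z ^ 2 + (a + a * I) ^ 2)) / (z - (a + a * I)) := by
    intro z
    rw [hF, div_div, mul_comm _ (z - _), ← fac_aux]
  simp only [hF']
  rw [this]
  congr 1
  have hp : (a + a * I : ℂ) ≠ 0 := by
    intro h; have := congrArg Complex.re h; simp at this; linarith
  generalize (a + a * I : ℂ) = p at hp
  field_simp
  ring

open Complex in
lemma F_bound (a ξ : ℝ) (R : ℝ) (hR : 0 < R) (hR4 : 8 * a ^ 4 ≤ R ^ 4) (z : ℂ) (hz : R ≤ ‖z‖) :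
    ‖Complex.exp (-ξ * z * I) * z ^ 3 / (((4 * a ^ 4 : ℝ) : ℂ) + z ^ 4)‖
      ≤ Real.exp (ξ * z.im) * (2 / R) := by
  have hz0 : 0 < ‖z‖ := hR.trans_le hz
  rw [norm_div, norm_mul, Complex.norm_exp, norm_pow, mul_div_assoc]
  have e : (-ξ * z * I : ℂ).re = ξ * z.im := by simp
  rw [e]
  refine mul_le_mul_of_nonneg_left ?_ (Real.exp_nonneg _)
  have hz4 : R ^ 4 ≤ ‖z‖ ^ 4 := by gcongr
  have h1 : ‖z‖ ^ 4 / 2 ≤ ‖((4 * a ^ 4 : ℝ) : ℂ) + z ^ 4‖ := by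
    have := norm_sub_norm_le (z ^ 4) (-((4 * a ^ 4 : ℝ) : ℂ))
    rw [norm_neg, norm_pow, Complex.norm_real, Real.norm_of_nonneg (by positivity),
      sub_neg_eq_add, add_comm] at this
    have : ‖z‖ ^ 4 / 2 ≤ ‖z‖ ^ 4 - 4 * a ^ 4 := by linarith
    linarith
  calc ‖z‖ ^ 3 / ‖((4 * a ^ 4 : ℝ) : ℂ) + z ^ 4‖ ≤ ‖z‖ ^ 3 / (‖z‖ ^ 4 / 2) := by gcongr
    _ = 2 / ‖z‖ := by field_simp
    _ ≤ 2 / R := by gcongr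

open Complex Filter Topology in
lemma contour_lim (a ξ : ℝ) (ha : 0 < a) (hξ : ξ < 0) (F : ℂ → ℂ)
    (hF : F = fun z => Complex.exp (-ξ * z * I) * z ^ 3 / (((4 * a ^ 4 : ℝ) : ℂ) + z ^ 4)) :
    Tendsto (fun R : ℝ => (∫ x in (0:ℝ)..R, F x) - I * (∫ y in (0:ℝ)..R, F (y * I))) atTop
      (𝓝 (2 * π * I * (Complex.exp (-ξ * (a + a * I) * I) / 4))) := by
  have hev : ∀ᶠ R : ℝ in atTop, a < R ∧ 0 < R ∧ 8 * a ^ 4 ≤ R ^ 4 := by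
    refine (eventually_gt_atTop a).and ((eventually_gt_atTop 0).and ?_)
    exact (tendsto_pow_atTop (by norm_num : (4:ℕ) ≠ 0)).eventually_ge_atTop _
  have htop : Tendsto (fun R : ℝ => ∫ x in (0:ℝ)..R, F (x + R * I)) atTop (𝓝 0) := by
    have hlim : Tendsto (fun R : ℝ => 2 * Real.exp (ξ * R)) atTop (𝓝 0) := by
      have : Tendsto (fun R : ℝ => Real.exp (ξ * R)) atTop (𝓝 0) :=
        Real.tendsto_exp_atBot.comp (tendsto_id.const_mul_atTop_of_neg hξ)
      simpa using this.const_mul 2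
    refine squeeze_zero_norm' ?_ hlim
    filter_upwards [hev] with R ⟨h1, h2, h3⟩
    have := intervalIntegral.norm_integral_le_of_norm_le_const (a := 0) (b := R)
      (f := fun x : ℝ => F (x + R * I)) (C := Real.exp (ξ * R) * (2 / R)) (by
        intro x hx
        have hb := F_bound a ξ R h2 h3 (x + R * I) (by
          have := Complex.abs_im_le_norm (x + R * I : ℂ)
          simp [abs_of_pos h2] at this
          exact this)
        simpa [hF] using hb)
    refine this.trans (le_of_eq ?_)
    rw [sub_zero, abs_of_pos h2]; field_simp
  have hright : Tendsto (fun R : ℝ => ∫ y in (0:ℝ)..R, F (R + y * I)) atTop (𝓝 0) := by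
    have hlim : Tendsto (fun R : ℝ => 2 * (-ξ)⁻¹ * R⁻¹) atTop (𝓝 0) := by
      simpa using tendsto_inv_atTop_zero.const_mul (2 * (-ξ)⁻¹)
    refine squeeze_zero_norm' ?_ hlim
    filter_upwards [hev] with R ⟨h1, h2, h3⟩
    have := intervalIntegral.norm_integral_le_of_norm_le (a := 0) (b := R) (μ := volume)
      (f := fun y : ℝ => F (R + y * I)) (g := fun y => Real.exp (ξ * y) * (2 / R)) h2.le
      (Eventually.of_forall (by
        intro x hx
        have hb := F_bound a ξ R h2 h3 (R + x * I) (by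
          have := Complex.abs_re_le_norm (R + x * I : ℂ)
          simp [abs_of_pos h2] at this
          exact this)
        simpa [hF] using hb)) (Continuous.intervalIntegrable (by fun_prop) _ _)
    refine this.trans ?_
    rw [intervalIntegral.integral_mul_const, intervalIntegral.integral_comp_mul_left
      (fun y => Real.exp y) hξ.ne, integral_exp, smul_eq_mul, mul_zero, Real.exp_zero]
    have e : 2 * (-ξ)⁻¹ * R⁻¹ - ξ⁻¹ * (Real.exp (ξ * R) - 1) * (2 / R)
        = (-ξ)⁻¹ * Real.exp (ξ * R) * (2 / R) := by
      rw [inv_neg]; ring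
    have : 0 ≤ (-ξ)⁻¹ * Real.exp (ξ * R) * (2 / R) := by
      have : 0 < -ξ := by linarith
      positivity
    linarith
  have hmain : Tendsto (fun R : ℝ => 2 * π * I * (Complex.exp (-ξ * (a + a * I) * I) / 4)
      + (∫ x in (0:ℝ)..R, F (x + R * I)) - I * (∫ y in (0:ℝ)..R, F (R + y * I))) atTop
      (𝓝 (2 * π * I * (Complex.exp (-ξ * (a + a * I) * I) / 4) + 0 - I * 0)) :=
    (tendsto_const_nhds.add htop).sub (hright.const_mul I)
  rw [mul_zero, sub_zero, add_zero] at hmain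
  refine hmain.congr' ?_
  filter_upwards [hev] with R ⟨h1, h2, h3⟩
  have := contour_eq a ξ ha R h1 F hF
  linear_combination -this

open Filter Topology in
lemma real_lim (a ξ : ℝ) (ha : 0 < a) (hξ : ξ < 0) :
    Tendsto (fun R : ℝ => ∫ x in (0:ℝ)..R,
      (Real.exp (ξ * x) - Real.sin (ξ * x) - Real.cos (ξ * x)) * (x ^ 3 / (4 * a ^ 4 + x ^ 4))) atTop
      (𝓝 (π / 2 * (Real.exp (ξ * a) * (Real.cos (ξ * a) - Real.sin (ξ * a))))) := by
  have h := contour_lim a ξ ha hξ _ rfl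
  have hre := (Complex.continuous_re.tendsto _).comp h
  have him := (Complex.continuous_im.tendsto _).comp h
  have hg : Continuous (fun x : ℝ => x ^ 3 / (4 * a ^ 4 + x ^ 4)) :=
    Continuous.div (by fun_prop) (by fun_prop) (fun x => by positivity)
  have hval : Complex.exp (-ξ * (a + a * Complex.I) * Complex.I)
      = (Real.exp (ξ * a) * Real.cos (ξ * a) : ℝ) - (Real.exp (ξ * a) * Real.sin (ξ * a) : ℝ) * Complex.I := by
    have : (-ξ * (a + a * Complex.I) * Complex.I : ℂ) = ((ξ * a : ℝ) : ℂ) + ((-(ξ * a) : ℝ) : ℂ) * Complex.I := by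
      push_cast
      linear_combination (-ξ * a : ℂ) * Complex.I_sq
    rw [this, Complex.exp_add, Complex.exp_mul_I, ← Complex.ofReal_cos, ← Complex.ofReal_sin,
      ← Complex.ofReal_exp, Real.cos_neg, Real.sin_neg]
    push_cast; ring
  have hfun : ∀ R : ℝ, (∫ x in (0:ℝ)..R, Complex.exp (-ξ * (x:ℂ) * Complex.I) * (x:ℂ) ^ 3 / (((4 * a ^ 4 : ℝ) : ℂ) + (x:ℂ) ^ 4))
      - Complex.I * (∫ y in (0:ℝ)..R, Complex.exp (-ξ * ((y:ℂ) * Complex.I) * Complex.I) * ((y:ℂ) * Complex.I) ^ 3 / (((4 * a ^ 4 : ℝ) : ℂ) + ((y:ℂ) * Complex.I) ^ 4))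
      = ((∫ x in (0:ℝ)..R, (Real.cos (ξ * x) - Real.exp (ξ * x)) * (x ^ 3 / (4 * a ^ 4 + x ^ 4)) : ℝ) : ℂ)
        - ((∫ x in (0:ℝ)..R, Real.sin (ξ * x) * (x ^ 3 / (4 * a ^ 4 + x ^ 4)) : ℝ) : ℂ) * Complex.I := by
    intro R
    have c1 : Continuous (fun x : ℝ => Complex.exp (-ξ * (x:ℂ) * Complex.I) * (x:ℂ) ^ 3 / (((4 * a ^ 4 : ℝ) : ℂ) + (x:ℂ) ^ 4)) := by
      refine Continuous.div (by fun_prop) (by fun_prop) (fun x => ?_)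
      have : (4 * a ^ 4 + x ^ 4 : ℝ) ≠ 0 := by positivity
      exact_mod_cast this
    have c2 : Continuous (fun y : ℝ => Complex.exp (-ξ * ((y:ℂ) * Complex.I) * Complex.I) * ((y:ℂ) * Complex.I) ^ 3 / (((4 * a ^ 4 : ℝ) : ℂ) + ((y:ℂ) * Complex.I) ^ 4)) := by
      refine Continuous.div (by fun_prop) (by fun_prop) (fun x => ?_)
      have : (4 * a ^ 4 + x ^ 4 : ℝ) ≠ 0 := by positivity
      rw [mul_pow, Complex.I_pow_four, mul_one]
      exact_mod_cast this
    rw [← intervalIntegral.integral_ofReal, ← intervalIntegral.integral_ofReal,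
      ← intervalIntegral.integral_const_mul, ← intervalIntegral.integral_mul_const,
      ← intervalIntegral.integral_sub (c1.intervalIntegrable _ _) (by exact (continuous_const.mul c2).intervalIntegrable _ _),
      ← intervalIntegral.integral_sub]
    · apply intervalIntegral.integral_congr
      intro x _
      simp only
      have e1 : (-ξ * (x:ℂ) * Complex.I) = ((-(ξ * x) : ℝ) : ℂ) * Complex.I := by push_cast; ring
      have e2 : (-ξ * ((x:ℂ) * Complex.I) * Complex.I) = ((ξ * x : ℝ) : ℂ) := by
        push_cast; linear_combination (-ξ * x : ℂ) * Complex.I_sq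
      rw [e1, e2, Complex.exp_mul_I, ← Complex.ofReal_cos, ← Complex.ofReal_sin,
      ← Complex.ofReal_exp, Real.cos_neg, Real.sin_neg, mul_pow, mul_pow, Complex.I_pow_four,
        Complex.I_pow_three]
      push_cast
      linear_combination (Complex.exp (ξ * x) * (x:ℂ)^3 / (4 * (a:ℂ) ^ 4 + (x:ℂ) ^ 4)) * Complex.I_sq
    · apply Continuous.intervalIntegrable
      have := hg
      exact Complex.continuous_ofReal.comp (by fun_prop)
    · apply Continuous.intervalIntegrable
      have := hg
      exact (Complex.continuous_ofReal.comp (by fun_prop)).mul continuous_const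
  have this : (2 * π * Complex.I * (Complex.exp (-ξ * (a + a * Complex.I) * Complex.I) / 4))
      = ((π / 2 * (Real.exp (ξ * a) * Real.sin (ξ * a)) : ℝ) : ℂ)
      + ((π / 2 * (Real.exp (ξ * a) * Real.cos (ξ * a)) : ℝ) : ℂ) * Complex.I := by
    rw [hval]; push_cast
    linear_combination (- π / 2 * (Complex.exp (ξ * a) * Complex.sin (ξ * a)) : ℂ) * Complex.I_sq
  have hsum := him.sub hre
  rw [this] at hsum
  have hL : ∀ u v : ℝ, ((u : ℂ) + v * Complex.I).im - ((u : ℂ) + v * Complex.I).re = v - u := by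
    intro u v; simp
  rw [hL] at hsum
  have hLL : π / 2 * (Real.exp (ξ * a) * (Real.cos (ξ * a) - Real.sin (ξ * a)))
    = π / 2 * (Real.exp (ξ * a) * Real.cos (ξ * a)) - π / 2 * (Real.exp (ξ * a) * Real.sin (ξ * a)) := by ring
  rw [hLL]
  refine hsum.congr (fun R => ?_)
  simp only [Function.comp]
  rw [hfun R]
  have hL2 : ∀ u v : ℝ, ((u : ℂ) - v * Complex.I).im - ((u : ℂ) - v * Complex.I).re = - v - u := by
    intro u v; simp
  rw [hL2, ← intervalIntegral.integral_neg, ← intervalIntegral.integral_sub]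
  · apply intervalIntegral.integral_congr
    intro x _
    simp only
    ring
  · apply Continuous.intervalIntegrable; fun_prop
  · apply Continuous.intervalIntegrable; fun_prop

lemma int_pow_exp (t : ℝ) (ht : 0 < t) (n : ℕ) :
    IntegrableOn (fun r : ℝ => r ^ n * Real.exp (-t * r ^ 4)) (Ioi 0) := by
  have h := integrableOn_rpow_mul_exp_neg_mul_rpow (p := 4) (s := n) (b := t)
    (by have : (0:ℝ) ≤ n := by positivity
        linarith) (by norm_num) ht
  refine h.congr_fun (fun r _ => ?_) measurableSet_Ioi
  simp only
  norm_cast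

lemma tendsto_pow_exp (t : ℝ) (ht : 0 < t) (n : ℕ) :
    Filter.Tendsto (fun r : ℝ => r ^ n * Real.exp (-t * r ^ 4)) Filter.atTop (nhds 0) := by
  have h := tendsto_rpow_mul_exp_neg_mul_atTop_nhds_zero n t ht
  refine squeeze_zero' ?_ ?_ h
  · filter_upwards [Filter.eventually_ge_atTop 0] with r hr
    positivity
  · filter_upwards [Filter.eventually_ge_atTop 1] with r hr
    rw [Real.rpow_natCast]
    gcongr ?_ * Real.exp ?_
    have : r ≤ r ^ 4 := le_self_pow₀ hr (by norm_num)
    nlinarith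

lemma bdd_HH (ξ r : ℝ) (hξ : ξ < 0) (hr : 0 ≤ r) :
    |(Real.exp (ξ * r) + Real.cos (ξ * r) - Real.sin (ξ * r)) / ξ| ≤ 3 / |ξ| := by
  rw [abs_div]
  gcongr
  have h1 : Real.exp (ξ * r) ≤ 1 := Real.exp_le_one_iff.2 (by nlinarith)
  have h2 := Real.exp_pos (ξ * r)
  rw [abs_le]
  constructor <;> linarith [Real.cos_le_one (ξ * r), Real.neg_one_le_cos (ξ * r), Real.sin_le_one (ξ * r), Real.neg_one_le_sin (ξ * r)]

lemma bdd_k (ξ r : ℝ) (hξ : ξ < 0) (hr : 0 ≤ r) :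
    |Real.exp (ξ * r) - Real.cos (ξ * r) + Real.sin (ξ * r)| ≤ 3 := by
  have h1 : Real.exp (ξ * r) ≤ 1 := Real.exp_le_one_iff.2 (by nlinarith)
  have h2 := Real.exp_pos (ξ * r)
  rw [abs_le]
  constructor <;> linarith [Real.cos_le_one (ξ * r), Real.neg_one_le_cos (ξ * r), Real.sin_le_one (ξ * r), Real.neg_one_le_sin (ξ * r)]

lemma bdd_h (ξ r : ℝ) (hξ : ξ < 0) (hr : 0 ≤ r) :
    |Real.exp (ξ * r) - Real.sin (ξ * r) - Real.cos (ξ * r)| ≤ 3 := by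
  have h1 : Real.exp (ξ * r) ≤ 1 := Real.exp_le_one_iff.2 (by nlinarith)
  have h2 := Real.exp_pos (ξ * r)
  rw [abs_le]
  constructor <;> linarith [Real.cos_le_one (ξ * r), Real.neg_one_le_cos (ξ * r), Real.sin_le_one (ξ * r), Real.neg_one_le_sin (ξ * r)]

lemma hasDeriv_h (ξ r : ℝ) :
    HasDerivAt (fun r => Real.exp (ξ * r) - Real.sin (ξ * r) - Real.cos (ξ * r))
      (ξ * (Real.exp (ξ * r) - Real.cos (ξ * r) + Real.sin (ξ * r))) r := by
  have h0 : HasDerivAt (fun r : ℝ => ξ * r) ξ r := by simpa using (hasDerivAt_id r).const_mul ξ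
  exact ((h0.exp.sub h0.sin).sub h0.cos).congr_deriv (by ring)

lemma hasDeriv_HH (ξ r : ℝ) (hξ : ξ ≠ 0) :
    HasDerivAt (fun r => (Real.exp (ξ * r) + Real.cos (ξ * r) - Real.sin (ξ * r)) / ξ)
      (Real.exp (ξ * r) - Real.sin (ξ * r) - Real.cos (ξ * r)) r := by
  have h0 : HasDerivAt (fun r : ℝ => ξ * r) ξ r := by simpa using (hasDerivAt_id r).const_mul ξ
  exact (((h0.exp.add h0.cos).sub h0.sin).div_const ξ).congr_deriv (by field_simp; ring)

lemma J0_eq (t ξ : ℝ) (ht : 0 < t) (hξ : ξ < 0) :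
    J0 t ξ = -(2 / π) * ∫ r in Ioi (0:ℝ), (Real.exp (ξ * r) + Real.cos (ξ * r) - Real.sin (ξ * r)) / ξ
      * (3 * r ^ 2 - 4 * t * r ^ 6) * Real.exp (-t * r ^ 4) := by
  have hpi := Real.pi_pos
  have i1 : IntegrableOn (fun r : ℝ => (Real.exp (ξ * r) - Real.cos (ξ * r) + Real.sin (ξ * r))
      * Real.exp (-t * r ^ 4)) (Ioi 0) := by
    refine Integrable.bdd_mul (c := 3) (by simpa [IntegrableOn] using int_pow_exp t ht 0) ?_ ?_
    · exact Continuous.aestronglyMeasurable (by fun_prop)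
    · filter_upwards [ae_restrict_mem measurableSet_Ioi] with r hr
      exact bdd_k ξ r hξ (le_of_lt hr)
  have i2 : IntegrableOn (fun r : ℝ => (Real.exp (ξ * r) + Real.cos (ξ * r) - Real.sin (ξ * r)) / ξ
      * (3 * r ^ 2 - 4 * t * r ^ 6) * Real.exp (-t * r ^ 4)) (Ioi 0) := by
    have hi : IntegrableOn (fun r : ℝ => 3 * (r ^ 2 * Real.exp (-t * r ^ 4))
        - 4 * t * (r ^ 6 * Real.exp (-t * r ^ 4))) (Ioi 0) :=
      ((int_pow_exp t ht 2).const_mul 3).sub ((int_pow_exp t ht 6).const_mul (4 * t))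
    have := Integrable.bdd_mul (c := 3 / |ξ|) (f := fun r : ℝ => (Real.exp (ξ * r) + Real.cos (ξ * r) - Real.sin (ξ * r)) / ξ) hi
      (Continuous.aestronglyMeasurable (by fun_prop)) (by
        filter_upwards [ae_restrict_mem measurableSet_Ioi] with r hr
        exact bdd_HH ξ r hξ (le_of_lt hr))
    refine this.congr (Filter.Eventually.of_forall fun r => ?_)
    simp only
    ring
  have key := integral_Ioi_of_hasDerivAt_of_tendsto (a := 0) (m := 0)
    (f := fun r : ℝ => (1 / (2 * π * t)) * ((Real.exp (ξ * r) - Real.sin (ξ * r) - Real.cos (ξ * r)) * Real.exp (-t * r ^ 4))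
      + (2 / π) * ((Real.exp (ξ * r) + Real.cos (ξ * r) - Real.sin (ξ * r)) / ξ * (r ^ 3 * Real.exp (-t * r ^ 4))))
    (f' := fun r : ℝ => (ξ / (2 * π * t)) * ((Real.exp (ξ * r) - Real.cos (ξ * r) + Real.sin (ξ * r))
      * Real.exp (-t * r ^ 4)) + (2 / π) * ((Real.exp (ξ * r) + Real.cos (ξ * r) - Real.sin (ξ * r)) / ξ
      * (3 * r ^ 2 - 4 * t * r ^ 6) * Real.exp (-t * r ^ 4))) ?_ ?_ ?_ ?_
  · rw [integral_add (i1.const_mul _) (i2.const_mul _), integral_const_mul, integral_const_mul] at key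
    simp at key
    rw [J0]
    simp only [neg_mul] at key ⊢
    linarith
  · exact Continuous.continuousWithinAt (by fun_prop)
  · intro r _
    have hE : HasDerivAt (fun r : ℝ => Real.exp (-t * r ^ 4)) (Real.exp (-t * r ^ 4) * (-t * (4 * r ^ 3))) r := by
      simpa using ((hasDerivAt_pow 4 r).const_mul (-t)).exp
    have h3 : HasDerivAt (fun r : ℝ => r ^ 3) (3 * r ^ 2) r := by
      simpa using hasDerivAt_pow 3 r
    refine ((((hasDeriv_h ξ r).mul hE).const_mul _).add
      (((hasDeriv_HH ξ r hξ.ne).mul (h3.mul hE)).const_mul _)).congr_deriv ?_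
    simp only [Pi.mul_apply]
    have hx0 : ξ ≠ 0 := hξ.ne
    field_simp
    ring
  · exact (i1.const_mul _).add (i2.const_mul _)
  · have z1 : Filter.Tendsto (fun r : ℝ => (Real.exp (ξ * r) - Real.sin (ξ * r) - Real.cos (ξ * r)) * Real.exp (-t * r ^ 4)) Filter.atTop (nhds 0) := by
      have := (tendsto_pow_exp t ht 0).const_mul 3
      rw [mul_zero] at this
      refine squeeze_zero_norm' ?_ this
      filter_upwards [Filter.eventually_ge_atTop 0] with r hr
      rw [norm_mul, Real.norm_eq_abs, Real.norm_of_nonneg (Real.exp_nonneg _), pow_zero, one_mul]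
      gcongr
      exact bdd_h ξ r hξ hr
    have z2 : Filter.Tendsto (fun r : ℝ => (Real.exp (ξ * r) + Real.cos (ξ * r) - Real.sin (ξ * r)) / ξ * (r ^ 3 * Real.exp (-t * r ^ 4))) Filter.atTop (nhds 0) := by
      have := (tendsto_pow_exp t ht 3).const_mul (3 / |ξ|)
      rw [mul_zero] at this
      refine squeeze_zero_norm' ?_ this
      filter_upwards [Filter.eventually_ge_atTop 0] with r hr
      rw [norm_mul, Real.norm_eq_abs, Real.norm_of_nonneg (by positivity)]
      gcongr
      exact bdd_HH ξ r hξ hr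
    simpa using (z1.const_mul (1 / (2 * π * t))).add (z2.const_mul (2 / π))

lemma int_t0 (c : ℝ) (hc : 0 < c) : IntegrableOn (fun t : ℝ => Real.exp (-c * t)) (Ioi 0) ∧
    ∫ t in Ioi (0:ℝ), Real.exp (-c * t) = 1 / c := by
  refine ⟨integrableOn_exp_mul_Ioi (by linarith) 0, ?_⟩
  rw [integral_exp_mul_Ioi (by linarith)]
  simp

lemma int_t1 (c : ℝ) (hc : 0 < c) : IntegrableOn (fun t : ℝ => t * Real.exp (-c * t)) (Ioi 0) ∧
    ∫ t in Ioi (0:ℝ), t * Real.exp (-c * t) = 1 / c ^ 2 := by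
  constructor
  · have h := integrableOn_rpow_mul_exp_neg_mul_rpow (p := 1) (s := 1) (b := c)
      (by norm_num) (by norm_num) hc
    simpa using h
  · have h := Real.integral_rpow_mul_exp_neg_mul_Ioi (a := 2) (r := c) (by norm_num) hc
    norm_num at h
    simpa using h

lemma int_r (lam : ℝ) (hlam : 0 < lam) :
    IntegrableOn (fun r : ℝ => r ^ 2 / (lam + r ^ 4)) (Ioi 0) := by
  have hi : Integrable (fun r : ℝ => (2 + 1 / lam) * (1 + r ^ 2)⁻¹) :=
    integrable_inv_one_add_sq.const_mul _
  refine (Integrable.mono' hi ?_ ?_).integrableOn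
  · exact Continuous.aestronglyMeasurable (Continuous.div (by fun_prop) (by fun_prop) (fun r => by positivity))
  · refine Filter.Eventually.of_forall fun r => ?_
    rw [Real.norm_of_nonneg (by positivity), ← div_eq_mul_inv, div_le_div_iff₀ (by positivity) (by positivity)]
    have : (2 + 1 / lam) * (lam + r ^ 4) = 2 * lam + 1 + 2 * r ^ 4 + r ^ 4 / lam := by field_simp; ring
    rw [this]
    have : 0 ≤ r ^ 4 / lam := by positivity
    nlinarith [sq_nonneg (r ^ 2 - 1)]

lemma fubini_part (lam ξ : ℝ) (hlam : 0 < lam) (hξ : ξ < 0) :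
    (∫ t in Ioi (0:ℝ), ∫ r in Ioi (0:ℝ), Real.exp (-lam * t) * ((Real.exp (ξ * r) + Real.cos (ξ * r) - Real.sin (ξ * r)) / ξ
      * (3 * r ^ 2 - 4 * t * r ^ 6) * Real.exp (-t * r ^ 4)))
    = ∫ r in Ioi (0:ℝ), (Real.exp (ξ * r) + Real.cos (ξ * r) - Real.sin (ξ * r)) / ξ *
       (3 * r ^ 2 / (lam + r ^ 4) - 4 * r ^ 6 / (lam + r ^ 4) ^ 2) := by
  have hE : ∀ r t : ℝ, Real.exp (-lam * t) * Real.exp (-t * r ^ 4) = Real.exp (-(lam + r ^ 4) * t) := by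
    intro r t; rw [← Real.exp_add]; ring_nf
  have hG : Integrable (fun q : ℝ × ℝ => (3 / |ξ|) * ((3 * q.2 ^ 2) * Real.exp (-(lam + q.2 ^ 4) * q.1)
      + (4 * q.2 ^ 6) * (q.1 * Real.exp (-(lam + q.2 ^ 4) * q.1))))
      ((volume.restrict (Ioi 0)).prod (volume.restrict (Ioi 0))) := by
    refine Integrable.const_mul ?_ _
    rw [integrable_prod_iff' (Continuous.aestronglyMeasurable (by fun_prop))]
    constructor
    · refine Filter.Eventually.of_forall fun r => ?_
      have hc : 0 < lam + r ^ 4 := by positivity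
      exact ((int_t0 _ hc).1.const_mul (3 * r ^ 2)).add ((int_t1 _ hc).1.const_mul (4 * r ^ 6))
    · have hval : ∀ r : ℝ, ∫ t in Ioi (0:ℝ), ‖(3 * r ^ 2) * Real.exp (-(lam + r ^ 4) * t)
          + (4 * r ^ 6) * (t * Real.exp (-(lam + r ^ 4) * t))‖
          = 3 * r ^ 2 * (1 / (lam + r ^ 4)) + 4 * r ^ 6 * (1 / (lam + r ^ 4) ^ 2) := by
        intro r
        have hc : 0 < lam + r ^ 4 := by positivity
        rw [← (int_t0 _ hc).2, ← (int_t1 _ hc).2, ← integral_const_mul, ← integral_const_mul,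
          ← integral_add ((int_t0 _ hc).1.const_mul _) ((int_t1 _ hc).1.const_mul _)]
        refine setIntegral_congr_fun measurableSet_Ioi fun t ht => ?_
        have ht' : 0 < t := ht
        rw [Real.norm_of_nonneg]
        positivity
      simp only [hval]
      refine Integrable.mono' ((int_r lam hlam).const_mul 7) ?_ ?_
      · refine Continuous.aestronglyMeasurable ?_
        have c1 : Continuous (fun r : ℝ => 1 / (lam + r ^ 4)) :=
          Continuous.div (by fun_prop) (by fun_prop) (fun r => by positivity)
        have c2 : Continuous (fun r : ℝ => 1 / (lam + r ^ 4) ^ 2) :=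
          Continuous.div (by fun_prop) (by fun_prop) (fun r => by positivity)
        fun_prop
      · refine Filter.Eventually.of_forall fun r => ?_
        rw [Real.norm_of_nonneg (by positivity)]
        have : 4 * r ^ 6 * (1 / (lam + r ^ 4) ^ 2) ≤ 4 * (r ^ 2 / (lam + r ^ 4)) := by
          have hc : 0 < lam + r ^ 4 := by positivity
          rw [mul_one_div, mul_div_assoc']
          rw [div_le_div_iff₀ (by positivity) hc]
          have : 0 ≤ 4 * r ^ 2 * (lam + r ^ 4) * lam := by positivity
          nlinarith
        have e : 3 * r ^ 2 * (1 / (lam + r ^ 4)) = 3 * (r ^ 2 / (lam + r ^ 4)) := by ring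
        linarith
  rw [integral_integral_swap]
  · refine setIntegral_congr_fun measurableSet_Ioi fun r _ => ?_
    have hc : 0 < lam + r ^ 4 := by positivity
    have : ∀ t : ℝ, Real.exp (-lam * t) * ((Real.exp (ξ * r) + Real.cos (ξ * r) - Real.sin (ξ * r)) / ξ
      * (3 * r ^ 2 - 4 * t * r ^ 6) * Real.exp (-t * r ^ 4))
      = (Real.exp (ξ * r) + Real.cos (ξ * r) - Real.sin (ξ * r)) / ξ *
       (3 * r ^ 2 * Real.exp (-(lam + r ^ 4) * t) - 4 * r ^ 6 * (t * Real.exp (-(lam + r ^ 4) * t))) := by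
      intro t; rw [← hE]; ring
    simp only [this]
    rw [integral_const_mul, integral_sub ((int_t0 _ hc).1.const_mul _) ((int_t1 _ hc).1.const_mul _),
      integral_const_mul, integral_const_mul, (int_t0 _ hc).2, (int_t1 _ hc).2]
    ring
  · refine Integrable.mono' hG (Continuous.aestronglyMeasurable (by unfold Function.uncurry; fun_prop)) ?_
    rw [Measure.prod_restrict]
    filter_upwards [ae_restrict_mem (measurableSet_Ioi.prod measurableSet_Ioi)] with q hq
    obtain ⟨h1, h2⟩ := hq
    have h1' : 0 < q.1 := h1
    have h2' : 0 < q.2 := h2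
    simp only [Function.uncurry]
    have : Real.exp (-lam * q.1) * ((Real.exp (ξ * q.2) + Real.cos (ξ * q.2) - Real.sin (ξ * q.2)) / ξ
      * (3 * q.2 ^ 2 - 4 * q.1 * q.2 ^ 6) * Real.exp (-q.1 * q.2 ^ 4))
      = (Real.exp (ξ * q.2) + Real.cos (ξ * q.2) - Real.sin (ξ * q.2)) / ξ *
       ((3 * q.2 ^ 2 - 4 * q.2 ^ 6 * q.1) * Real.exp (-(lam + q.2 ^ 4) * q.1)) := by
      rw [← hE]; ring
    rw [this, norm_mul, norm_mul, Real.norm_of_nonneg (Real.exp_nonneg _)]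
    have hb := bdd_HH ξ q.2 hξ h2'.le
    rw [← mul_assoc (4 * q.2 ^ 6), ← add_mul]
    gcongr
    · exact hb
    · refine (norm_sub_le _ _).trans (le_of_eq ?_)
      rw [Real.norm_of_nonneg (by positivity), Real.norm_of_nonneg (by positivity)]

open Filter Topology in
lemma ibp_part (lam ξ L : ℝ) (hlam : 0 < lam) (hξ : ξ < 0)
    (hL : Tendsto (fun R : ℝ => ∫ x in (0:ℝ)..R,
      (Real.exp (ξ * x) - Real.sin (ξ * x) - Real.cos (ξ * x)) * (x ^ 3 / (lam + x ^ 4))) atTop (𝓝 L)) :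
    ∫ r in Ioi (0:ℝ), (Real.exp (ξ * r) + Real.cos (ξ * r) - Real.sin (ξ * r)) / ξ *
       (3 * r ^ 2 / (lam + r ^ 4) - 4 * r ^ 6 / (lam + r ^ 4) ^ 2) = - L := by
  have cg : Continuous (fun r : ℝ => r ^ 3 / (lam + r ^ 4)) :=
    Continuous.div (by fun_prop) (by fun_prop) (fun r => by positivity)
  have c1 : Continuous (fun r : ℝ => 3 * r ^ 2 / (lam + r ^ 4)) :=
    Continuous.div (by fun_prop) (by fun_prop) (fun r => by positivity)
  have c2 : Continuous (fun r : ℝ => 4 * r ^ 6 / (lam + r ^ 4) ^ 2) :=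
    Continuous.div (by fun_prop) (by fun_prop) (fun r => by positivity)
  have hint : IntegrableOn (fun r : ℝ => (Real.exp (ξ * r) + Real.cos (ξ * r) - Real.sin (ξ * r)) / ξ *
       (3 * r ^ 2 / (lam + r ^ 4) - 4 * r ^ 6 / (lam + r ^ 4) ^ 2)) (Ioi 0) := by
    refine Integrable.bdd_mul (c := 3 / |ξ|) ?_ (Continuous.aestronglyMeasurable (by fun_prop)) ?_
    · refine Integrable.mono' ((int_r lam hlam).const_mul 7) (Continuous.aestronglyMeasurable (by fun_prop)) ?_
      refine Filter.Eventually.of_forall fun r => ?_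
      have : 4 * r ^ 6 / (lam + r ^ 4) ^ 2 ≤ 4 * (r ^ 2 / (lam + r ^ 4)) := by
        have hc : 0 < lam + r ^ 4 := by positivity
        rw [mul_div_assoc']
        rw [div_le_div_iff₀ (by positivity) hc]
        have : 0 ≤ 4 * r ^ 2 * (lam + r ^ 4) * lam := by positivity
        nlinarith
      refine (norm_sub_le _ _).trans ?_
      rw [Real.norm_of_nonneg (by positivity), Real.norm_of_nonneg (by positivity)]
      have e : 3 * r ^ 2 / (lam + r ^ 4) = 3 * (r ^ 2 / (lam + r ^ 4)) := by ring
      linarith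
    · filter_upwards [ae_restrict_mem measurableSet_Ioi] with r hr
      exact bdd_HH ξ r hξ (le_of_lt hr)
  have h1 := intervalIntegral_tendsto_integral_Ioi 0 hint tendsto_id
  have hbd : Tendsto (fun R : ℝ => (Real.exp (ξ * R) + Real.cos (ξ * R) - Real.sin (ξ * R)) / ξ * (R ^ 3 / (lam + R ^ 4))) atTop (𝓝 0) := by
    have := tendsto_inv_atTop_zero.const_mul (3 / |ξ|)
    rw [mul_zero] at this
    refine squeeze_zero_norm' ?_ this
    filter_upwards [Filter.eventually_gt_atTop 0] with r hr
    rw [norm_mul, Real.norm_eq_abs, Real.norm_of_nonneg (by positivity)]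
    gcongr
    · exact bdd_HH ξ r hξ hr.le
    · rw [inv_eq_one_div, div_le_div_iff₀ (by positivity) hr]
      nlinarith
  refine tendsto_nhds_unique h1 ?_
  have h2 := hbd.sub hL
  rw [zero_sub] at h2
  refine h2.congr (fun R => ?_)
  rw [sub_eq_iff_eq_add, id, ← intervalIntegral.integral_add]
  · rw [intervalIntegral.integral_eq_sub_of_hasDerivAt
      (f := fun R : ℝ => (Real.exp (ξ * R) + Real.cos (ξ * R) - Real.sin (ξ * R)) / ξ * (R ^ 3 / (lam + R ^ 4)))]
    · simp
    · intro r _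
      have hc : 0 < lam + r ^ 4 := by positivity
      have h3 : HasDerivAt (fun r : ℝ => r ^ 3) (3 * r ^ 2) r := by
        simpa using hasDerivAt_pow 3 r
      have h4 : HasDerivAt (fun r : ℝ => lam + r ^ 4) (4 * r ^ 3) r := by
        simpa using (hasDerivAt_pow 4 r).const_add lam
      refine ((hasDeriv_HH ξ r hξ.ne).mul (h3.div h4 hc.ne')).congr_deriv ?_
      simp only [Pi.div_apply]
      field_simp
      ring
    · exact Continuous.intervalIntegrable (by fun_prop) _ _
  · exact Continuous.intervalIntegrable (by fun_prop) _ _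
  · exact Continuous.intervalIntegrable (by fun_prop) _ _

/-- Laplace transform of `𝒥_0(·;ξ)` for `ξ < 0`:
`∫_0^∞ e^{−λt} 𝒥_0(t;ξ) dt = √2 e^{λ^{1/4} ξ/√2} cos(λ^{1/4} ξ/√2 + π/4)`. -/
theorem laplace_J0 (lam : ℝ) (hlam : 0 < lam) (ξ : ℝ) (hξ : ξ < 0) :
    ∫ t in Set.Ioi (0 : ℝ), Real.exp (-lam * t) * J0 t ξ
      = Real.sqrt 2 * Real.exp (lam ^ ((1 : ℝ) / 4) * ξ / Real.sqrt 2) *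
          Real.cos (lam ^ ((1 : ℝ) / 4) * ξ / Real.sqrt 2 + Real.pi / 4) := by
  have h2 : 0 < Real.sqrt 2 := by positivity
  set b : ℝ := lam ^ ((1 : ℝ) / 4) with hb
  have hb0 : 0 < b := Real.rpow_pos_of_pos hlam _
  have hb4 : b ^ 4 = lam := by
    rw [hb, ← Real.rpow_natCast, ← Real.rpow_mul hlam.le]
    norm_num
  have ha : 0 < b / Real.sqrt 2 := by positivity
  have hs4 : Real.sqrt 2 ^ 4 = 4 := by
    have := Real.sq_sqrt (show (0:ℝ) ≤ 2 by norm_num)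
    calc Real.sqrt 2 ^ 4 = (Real.sqrt 2 ^ 2) ^ 2 := by ring
      _ = 4 := by rw [this]; norm_num
  have ha4 : 4 * (b / Real.sqrt 2) ^ 4 = lam := by
    rw [div_pow, hs4, hb4]; ring
  have hlim := real_lim (b / Real.sqrt 2) ξ ha hξ
  rw [ha4] at hlim
  have hI := ibp_part lam ξ _ hlam hξ hlim
  have hF := fubini_part lam ξ hlam hξ
  have hstep : ∫ t in Set.Ioi (0 : ℝ), Real.exp (-lam * t) * J0 t ξ
      = -(2 / π) * (∫ t in Ioi (0:ℝ), ∫ r in Ioi (0:ℝ), Real.exp (-lam * t) * ((Real.exp (ξ * r) + Real.cos (ξ * r) - Real.sin (ξ * r)) / ξ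
      * (3 * r ^ 2 - 4 * t * r ^ 6) * Real.exp (-t * r ^ 4))) := by
    rw [← integral_const_mul]
    refine setIntegral_congr_fun measurableSet_Ioi fun t ht => ?_
    simp only [integral_const_mul]
    rw [J0_eq t ξ ht hξ]
    ring
  rw [hstep, hF, hI, Real.cos_add, Real.cos_pi_div_four, Real.sin_pi_div_four]
  have e : b * ξ / Real.sqrt 2 = ξ * (b / Real.sqrt 2) := by ring
  rw [e]
  have hpi := Real.pi_pos
  generalize ξ * (b / Real.sqrt 2) = u
  have hs2 := Real.sq_sqrt (show (0:ℝ) ≤ 2 by norm_num)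
  have e2 : -(2 / π) * -(π / 2 * (Real.exp u * (Real.cos u - Real.sin u))) = Real.exp u * (Real.cos u - Real.sin u) := by
    field_simp
  rw [e2]
  linear_combination (-(Real.exp u * (Real.cos u - Real.sin u)) / 2) * hs2
end
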